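/- Under A1–A3, suppose f(θ) = T_c(ρ(·,θ),ρ*) is Gâteaux differentiable at θ₀. Then for every ε > 0 there exists δ > 0 such that for every admissible dual pair (φ,ψ) ∈ Φ_c(ρ(·,θ₀),ρ*) with dual value I(φ,ψ,θ₀) > f(θ₀) − δ, one has |∇f(θ₀) − ∫_Ω φ^{cc}(x) ∇_θ ρ(x,θ₀) dx| < ε. -/

import Mathlib

open MeasureTheory Set Filter

/-- The Kantorovich optimal transport cost between two measures. -/
noncomputable def Tc {X : Type*} [MeasurableSpace X] (c : X × X → ℝ)
    (μ ν : Measure X) : ℝ :=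
  sInf {r : ℝ | ∃ π : Measure (X × X),
    π.map Prod.fst = μ ∧ π.map Prod.snd = ν ∧ r = ∫ z, c z ∂π}

/-- Admissible Kantorovich dual pairs `(φ, ψ)` on `Ω` for the cost `c`. -/
def dualPairs {X : Type*} [TopologicalSpace X] (Ω : Set X) (c : X × X → ℝ) :
    Set ((X → ℝ) × (X → ℝ)) :=
  {p | ContinuousOn p.1 Ω ∧ ContinuousOn p.2 Ω ∧
    ∀ x ∈ Ω, ∀ y ∈ Ω, p.1 x + p.2 y ≤ c (x, y)}

/-- The `c`-transform `φ^c(y) = inf_{x ∈ Ω} (c(x,y) − φ(x))`. -/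
noncomputable def cT1 {X : Type*} (Ω : Set X) (c : X × X → ℝ) (φ : X → ℝ) : X → ℝ :=
  fun y => sInf ((fun x => c (x, y) - φ x) '' Ω)

/-- The `c`-transform `ψ^c(x) = inf_{y ∈ Ω} (c(x,y) − ψ(y))`. -/
noncomputable def cT2 {X : Type*} (Ω : Set X) (c : X × X → ℝ) (ψ : X → ℝ) : X → ℝ :=
  fun x => sInf ((fun y => c (x, y) - ψ y) '' Ω)

lemma aux_ext {X : Type*} [TopologicalSpace X] [NormalSpace X] [T2Space X] {K : Set X}
    (hK : IsCompact K) {φ : X → ℝ} (hφ : ContinuousOn φ K) :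
    ∃ F : X → ℝ, Continuous F ∧ (∃ B, ∀ x, ‖F x‖ ≤ B) ∧ ∀ x ∈ K, F x = φ x := by
  have : CompactSpace K := isCompact_iff_compactSpace.mp hK
  let r : BoundedContinuousFunction K ℝ :=
    BoundedContinuousFunction.mkOfCompact ⟨K.domRestrict φ, hφ.domRestrict⟩
  obtain ⟨G, -, hG⟩ := BoundedContinuousFunction.exists_norm_eq_domRestrict_eq_of_closed r
    hK.isClosed
  refine ⟨G, G.continuous, ⟨‖G‖, G.norm_coe_le_norm⟩, fun x hx => ?_⟩
  have := congrArg (fun h => h ⟨x, hx⟩) hG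
  exact this

lemma aux_cT1_cont {X : Type*} [TopologicalSpace X] [NormalSpace X] [T2Space X] {K : Set X}
    (hK : IsCompact K) {c : X × X → ℝ} (hc : Continuous c)
    {φ : X → ℝ} (hφ : ContinuousOn φ K) : Continuous (cT1 K c φ) := by
  obtain ⟨F, hF, -, hFe⟩ := aux_ext hK hφ
  have h : cT1 K c φ = fun y => sInf ((fun x => c (x, y) - F x) '' K) := by
    funext y
    unfold cT1
    congr 1
    exact Set.image_congr (fun x hx => by rw [hFe x hx])
  rw [h]
  apply IsCompact.continuous_sInf hK (f := fun y x => c (x, y) - F x)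
  unfold Function.HasUncurry.uncurry Function.hasUncurryInduction
  simp only [Function.HasUncurry.uncurry, id]
  fun_prop

lemma aux_cT2_cont {X : Type*} [TopologicalSpace X] {K : Set X}
    (hK : IsCompact K) {c : X × X → ℝ} (hc : Continuous c)
    {ψ : X → ℝ} (hψ : Continuous ψ) : Continuous (cT2 K c ψ) := by
  apply IsCompact.continuous_sInf hK (f := fun x y => c (x, y) - ψ y)
  unfold Function.HasUncurry.uncurry Function.hasUncurryInduction
  simp only [Function.HasUncurry.uncurry, id]
  fun_prop

lemma aux_cT1_le {X : Type*} [TopologicalSpace X] {K : Set X}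
    (hK : IsCompact K) {c : X × X → ℝ} (hc : Continuous c)
    {φ : X → ℝ} (hφ : ContinuousOn φ K) {x y : X} (hx : x ∈ K) :
    cT1 K c φ y ≤ c (x, y) - φ x := by
  refine csInf_le ?_ ⟨x, hx, rfl⟩
  exact (hK.image_of_continuousOn
    (ContinuousOn.sub (by fun_prop) hφ)).bddBelow

lemma aux_cT2_le {X : Type*} [TopologicalSpace X] {K : Set X}
    (hK : IsCompact K) {c : X × X → ℝ} (hc : Continuous c)
    {ψ : X → ℝ} (hψ : ContinuousOn ψ K) {x y : X} (hy : y ∈ K) :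
    cT2 K c ψ x ≤ c (x, y) - ψ y := by
  refine csInf_le ?_ ⟨y, hy, rfl⟩
  exact (hK.image_of_continuousOn
    (ContinuousOn.sub (by fun_prop) hψ)).bddBelow

/-- Weak duality. -/
lemma aux_weak {X : Type*} [TopologicalSpace X] [NormalSpace X] [T2Space X]
    [SecondCountableTopology X] [MeasurableSpace X] [BorelSpace X] {K : Set X}
    (hK : IsCompact K) {c : X × X → ℝ} (hc : Continuous c)
    (μ ν : Measure X) [IsProbabilityMeasure μ] [IsProbabilityMeasure ν]
    (hμ : μ Kᶜ = 0) (hν : ν Kᶜ = 0)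
    {a b : X → ℝ} (ha : Continuous a) (hb : Continuous b)
    (hab : ∀ x ∈ K, ∀ y ∈ K, a x + b y ≤ c (x, y)) :
    (∫ x, a x ∂μ) + ∫ y, b y ∂ν ≤ Tc c μ ν := by
  unfold Tc
  apply le_csInf
  · exact ⟨_, μ.prod ν, by simp, by simp, rfl⟩
  · rintro r ⟨π, h1, h2, rfl⟩
    have hπ : IsProbabilityMeasure π := by
      constructor
      have : (π.map Prod.fst) univ = 1 := by rw [h1]; simp
      rwa [Measure.map_apply measurable_fst MeasurableSet.univ, preimage_univ] at this
    have hm : MeasurableSet Kᶜ := hK.isClosed.measurableSet.compl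
    have e1 : ∀ᵐ z ∂π, z.1 ∈ K := by
      have : (π.map Prod.fst) Kᶜ = 0 := by rw [h1]; exact hμ
      rw [Measure.map_apply measurable_fst hm] at this
      exact this
    have e2 : ∀ᵐ z ∂π, z.2 ∈ K := by
      have : (π.map Prod.snd) Kᶜ = 0 := by rw [h2]; exact hν
      rw [Measure.map_apply measurable_snd hm] at this
      exact this
    have hint : ∀ u : X × X → ℝ, Continuous u → Integrable u π := by
      intro u hu
      obtain ⟨B, hB⟩ := (hK.prod hK).exists_bound_of_continuousOn hu.continuousOn
      refine Integrable.of_bound hu.aestronglyMeasurable B ?_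
      filter_upwards [e1, e2] with z hz1 hz2
      exact hB z ⟨hz1, hz2⟩
    have i1 : ∫ x, a x ∂μ = ∫ z, a z.1 ∂π := by
      rw [← h1, integral_map measurable_fst.aemeasurable ha.aestronglyMeasurable]
    have i2 : ∫ x, b x ∂ν = ∫ z, b z.2 ∂π := by
      rw [← h2, integral_map measurable_snd.aemeasurable hb.aestronglyMeasurable]
    rw [i1, i2, ← integral_add (hint _ (by fun_prop)) (hint _ (by fun_prop))]
    apply integral_mono_ae (hint _ (by fun_prop)) (hint _ hc)
    filter_upwards [e1, e2] with z hz1 hz2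
    exact hab _ hz1 _ hz2

/-- Differentiation under the integral, in `L¹`. -/
lemma aux_L1 {X : Type*} [MeasurableSpace X] (μ : Measure X) (m : ℕ)
    (Θ : Set (Fin m → ℝ)) (hΘ : IsOpen Θ)
    (ρ : X → (Fin m → ℝ) → ℝ)
    (hρint : ∀ θ ∈ Θ, Integrable (fun x => ρ x θ) μ)
    (η : X → ℝ) (hη : Integrable η μ)
    (hρdiff : ∀ x, ∀ θ ∈ Θ, DifferentiableAt ℝ (ρ x) θ ∧ ‖fderiv ℝ (ρ x) θ‖ ≤ η x)
    (θ₀ : Fin m → ℝ) (hθ₀ : θ₀ ∈ Θ) (v : Fin m → ℝ) :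
    Integrable (fun x => (fderiv ℝ (ρ x) θ₀) v) μ ∧
    (∀ᶠ t : ℝ in nhdsWithin 0 (Ioi 0), θ₀ + t • v ∈ Θ) ∧
    Tendsto (fun t : ℝ => ∫ x, ‖(ρ x (θ₀ + t • v) - ρ x θ₀) / t - (fderiv ℝ (ρ x) θ₀) v‖ ∂μ)
      (nhdsWithin 0 (Ioi 0)) (nhds 0) := by
  obtain ⟨r, hr, hball⟩ := Metric.isOpen_iff.mp hΘ θ₀ hθ₀
  have hev : ∀ᶠ t : ℝ in nhdsWithin 0 (Ioi 0), θ₀ + t • v ∈ Metric.ball θ₀ r := by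
    have hcont : Continuous (fun t : ℝ => θ₀ + t • v) := by fun_prop
    have h0 : Tendsto (fun t : ℝ => θ₀ + t • v) (nhds 0) (nhds θ₀) := by
      simpa using hcont.tendsto 0
    exact (h0.mono_left nhdsWithin_le_nhds) (Metric.ball_mem_nhds θ₀ hr)
  have hevΘ : ∀ᶠ t : ℝ in nhdsWithin 0 (Ioi 0), θ₀ + t • v ∈ Θ := hev.mono fun t ht => hball ht
  have hlim : ∀ x, Tendsto (fun t : ℝ => (ρ x (θ₀ + t • v) - ρ x θ₀) / t)
      (nhdsWithin 0 (Ioi 0)) (nhds ((fderiv ℝ (ρ x) θ₀) v)) := by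
    intro x
    have h := ((hρdiff x θ₀ hθ₀).1.hasFDerivAt.hasLineDerivAt v)
    have h2 := HasDerivAt.tendsto_slope_zero_right h
    refine h2.congr fun t => ?_
    simp [div_eq_inv_mul]
  have hbd : ∀ x, ‖(fderiv ℝ (ρ x) θ₀) v‖ ≤ η x * ‖v‖ := fun x =>
    (ContinuousLinearMap.le_opNorm _ _).trans
      (mul_le_mul_of_nonneg_right (hρdiff x θ₀ hθ₀).2 (norm_nonneg _))
  have hqm : ∀ t : ℝ, θ₀ + t • v ∈ Θ →
      Integrable (fun x => (ρ x (θ₀ + t • v) - ρ x θ₀) / t) μ := fun t ht =>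
    ((hρint _ ht).sub (hρint _ hθ₀)).div_const t
  have hmeas : AEStronglyMeasurable (fun x => (fderiv ℝ (ρ x) θ₀) v) μ := by
    classical
    refine aestronglyMeasurable_of_tendsto_ae (nhdsWithin (0:ℝ) (Ioi 0))
      (f := fun t x => if θ₀ + t • v ∈ Θ then (ρ x (θ₀ + t • v) - ρ x θ₀) / t else 0) ?_ ?_
    · intro t
      by_cases ht : θ₀ + t • v ∈ Θ
      · simpa only [ht, if_true] using (hqm t ht).aestronglyMeasurable
      · simpa only [ht, if_false] using aestronglyMeasurable_const
    · refine Eventually.of_forall fun x => (hlim x).congr' ?_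
      filter_upwards [hevΘ] with t ht
      simp [ht]
  have hint : Integrable (fun x => (fderiv ℝ (ρ x) θ₀) v) μ :=
    (hη.mul_const ‖v‖).mono' hmeas (Eventually.of_forall hbd)
  refine ⟨hint, hevΘ, ?_⟩
  have := tendsto_integral_filter_of_dominated_convergence (μ := μ)
    (l := nhdsWithin (0:ℝ) (Ioi 0))
    (F := fun t x => ‖(ρ x (θ₀ + t • v) - ρ x θ₀) / t - (fderiv ℝ (ρ x) θ₀) v‖)
    (f := fun _ => 0) (fun x => 2 * (η x * ‖v‖)) ?_ ?_ ((hη.mul_const ‖v‖).const_mul 2) ?_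
  · simpa using this
  · filter_upwards [hevΘ] with t ht
    exact ((hqm t ht).sub hint).norm.aestronglyMeasurable
  · filter_upwards [hev, self_mem_nhdsWithin] with t ht htpos
    refine Eventually.of_forall fun x => ?_
    have htpos : 0 < t := htpos
    have h1 := (convex_ball θ₀ r).norm_image_sub_le_of_norm_fderiv_le (𝕜 := ℝ)
      (fun y hy => (hρdiff x y (hball hy)).1) (fun y hy => (hρdiff x y (hball hy)).2)
      (Metric.mem_ball_self hr) ht
    have h2 : ‖(ρ x (θ₀ + t • v) - ρ x θ₀) / t‖ ≤ η x * ‖v‖ := by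
      rw [norm_div, div_le_iff₀ (by simpa using htpos.ne')]
      calc _ ≤ _ := h1
        _ = _ := by rw [add_sub_cancel_left, norm_smul]; ring
    rw [norm_norm]
    calc _ ≤ _ := norm_sub_le _ _
      _ ≤ _ := by linarith [hbd x]
  · refine Eventually.of_forall fun x => ?_
    have := ((hlim x).sub_const ((fderiv ℝ (ρ x) θ₀) v)).norm
    simpa using this

/-- The one-sided estimate in one direction. -/
lemma aux_dir {X : Type*} [MeasurableSpace X] (μ : Measure X) (m : ℕ) (Ω : Set X)
    (Θ : Set (Fin m → ℝ)) (hΘ : IsOpen Θ)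
    (ρ : X → (Fin m → ℝ) → ℝ)
    (hρint : ∀ θ ∈ Θ, Integrable (fun x => ρ x θ) μ)
    (hρprob : ∀ θ ∈ Θ, (∀ x, 0 ≤ ρ x θ) ∧ (∫ x, ρ x θ ∂μ) = 1 ∧ ∀ x ∉ Ω, ρ x θ = 0)
    (η : X → ℝ) (hη : Integrable η μ)
    (hρdiff : ∀ x, ∀ θ ∈ Θ, DifferentiableAt ℝ (ρ x) θ ∧ ‖fderiv ℝ (ρ x) θ‖ ≤ η x)
    (f : (Fin m → ℝ) → ℝ)
    (θ₀ : Fin m → ℝ) (hθ₀ : θ₀ ∈ Θ) (v : Fin m → ℝ) (gv : ℝ)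
    (hg : Tendsto (fun t : ℝ => (f (θ₀ + t • v) - f θ₀) / t) (nhdsWithin 0 (Ioi 0)) (nhds gv))
    (hzero : ∀ x ∉ Ω, (fderiv ℝ (ρ x) θ₀) v = 0)
    (C : ℝ) (ε : ℝ) (hε : 0 < ε) :
    ∃ δ > (0 : ℝ), ∀ (a : X → ℝ) (k β : ℝ), AEStronglyMeasurable a μ → (∃ B, ∀ x, ‖a x‖ ≤ B) →
      (∀ x ∈ Ω, |a x - k| ≤ C) →
      (∀ θ ∈ Θ, (∫ x, a x * ρ x θ ∂μ) + β ≤ f θ) →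
      f θ₀ - δ < (∫ x, a x * ρ x θ₀ ∂μ) + β →
      ∫ x, a x * (fderiv ℝ (ρ x) θ₀) v ∂μ < gv + ε := by
  obtain ⟨hint, hevΘ, hL⟩ := aux_L1 μ m Θ hΘ ρ hρint η hη hρdiff θ₀ hθ₀ v
  have hqi : ∀ t : ℝ, θ₀ + t • v ∈ Θ →
      Integrable (fun x => (ρ x (θ₀ + t • v) - ρ x θ₀) / t) μ := fun t ht =>
    ((hρint _ ht).sub (hρint _ hθ₀)).div_const t
  have hq0 : ∀ t : ℝ, θ₀ + t • v ∈ Θ →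
      ∫ x, (ρ x (θ₀ + t • v) - ρ x θ₀) / t - (fderiv ℝ (ρ x) θ₀) v ∂μ
        = - ∫ x, (fderiv ℝ (ρ x) θ₀) v ∂μ := by
    intro t ht
    rw [integral_sub (hqi t ht) hint, integral_div, integral_sub (hρint _ ht) (hρint _ hθ₀),
      (hρprob _ ht).2.1, (hρprob _ hθ₀).2.1]
    simp
  have hI0 : ∫ x, (fderiv ℝ (ρ x) θ₀) v ∂μ = 0 := by
    have : ‖∫ x, (fderiv ℝ (ρ x) θ₀) v ∂μ‖ ≤ 0 := by
      refine ge_of_tendsto hL ?_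
      filter_upwards [hevΘ] with t ht
      have := norm_integral_le_integral_norm (μ := μ)
        (fun x => (ρ x (θ₀ + t • v) - ρ x θ₀) / t - (fderiv ℝ (ρ x) θ₀) v)
      rwa [hq0 t ht, norm_neg] at this
    exact norm_le_zero_iff.mp this
  have hL2 : ∀ᶠ t : ℝ in nhdsWithin 0 (Ioi 0),
      C * ∫ x, ‖(ρ x (θ₀ + t • v) - ρ x θ₀) / t - (fderiv ℝ (ρ x) θ₀) v‖ ∂μ < ε / 3 := by
    have := hL.const_mul C
    rw [mul_zero] at this
    exact this.eventually_lt_const (by linarith)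
  have hg2 := hg.eventually_lt_const (show gv < gv + ε / 3 by linarith)
  obtain ⟨t, htΘ, htL, htg, htpos⟩ :=
    (hevΘ.and (hL2.and (hg2.and self_mem_nhdsWithin))).exists
  have htpos : 0 < t := htpos
  refine ⟨t * (ε / 3), by positivity, ?_⟩
  rintro a k β ham ⟨B, hB⟩ hak hweak hopt
  have hai : ∀ u : X → ℝ, Integrable u μ → Integrable (fun x => a x * u x) μ := fun u hu =>
    hu.bdd_mul ham (Eventually.of_forall hB)
  set D : X → ℝ := fun x => (ρ x (θ₀ + t • v) - ρ x θ₀) / t - (fderiv ℝ (ρ x) θ₀) v with hD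
  have hDi : Integrable D μ := (hqi t htΘ).sub hint
  have hD0 : ∫ x, D x ∂μ = 0 := by rw [hD, hq0 t htΘ, hI0, neg_zero]
  have hDout : ∀ x ∉ Ω, D x = 0 := by
    intro x hx
    simp [hD, (hρprob _ htΘ).2.2 x hx, (hρprob _ hθ₀).2.2 x hx, hzero x hx]
  have hA : ∫ x, a x * D x ∂μ = ∫ x, (a x - k) * D x ∂μ := by
    simp_rw [sub_mul]
    rw [integral_sub (hai _ hDi) (hDi.const_mul k), integral_const_mul, hD0]
    simp
  have hB2 : |∫ x, a x * D x ∂μ| < ε / 3 := by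
    rw [hA]
    calc |∫ x, (a x - k) * D x ∂μ| ≤ ∫ x, C * ‖D x‖ ∂μ := by
          rw [← Real.norm_eq_abs]
          refine norm_integral_le_of_norm_le (hDi.norm.const_mul C) (Eventually.of_forall ?_)
          intro x
          by_cases hx : x ∈ Ω
          · rw [norm_mul]
            exact mul_le_mul_of_nonneg_right (hak x hx) (norm_nonneg _)
          · simp [hDout x hx]
      _ = C * ∫ x, ‖D x‖ ∂μ := integral_const_mul _ _
      _ < ε / 3 := htL
  have hsplit : ∫ x, a x * (fderiv ℝ (ρ x) θ₀) v ∂μ =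
      ((∫ x, a x * ρ x (θ₀ + t • v) ∂μ) - ∫ x, a x * ρ x θ₀ ∂μ) / t - ∫ x, a x * D x ∂μ := by
    rw [← integral_sub (hai _ (hρint _ htΘ)) (hai _ (hρint _ hθ₀)), ← integral_div,
      ← integral_sub _ (hai _ hDi)]
    · congr 1
      funext x
      simp only [hD]
      ring
    · exact ((hai _ (hρint _ htΘ)).sub (hai _ (hρint _ hθ₀))).div_const t
  have h1 := hweak _ htΘ
  have h2 : ((∫ x, a x * ρ x (θ₀ + t • v) ∂μ) - ∫ x, a x * ρ x θ₀ ∂μ) / t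
      ≤ (f (θ₀ + t • v) - f θ₀) / t + ε / 3 := by
    rw [div_add' _ _ _ htpos.ne', div_le_div_iff_of_pos_right htpos]
    linarith
  rw [hsplit]
  have := abs_lt.mp hB2
  linarith [this.1]

/-- Under A1–A3, if `f(θ) = T_c(ρ(·,θ), ρ*)` is Gâteaux
differentiable at `θ₀` with Gâteaux derivative `g`, then for every `ε > 0` there is
`δ > 0` such that every admissible dual pair `(φ,ψ)` whose dual value exceeds
`f(θ₀) − δ` gives an `ε`-accurate gradient via the double `c`-transform `φ^{cc}`. -/
theorem stmt18 (d m : ℕ)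
    (Ω : Set (EuclideanSpace ℝ (Fin d))) (hΩ : IsCompact Ω)
    (Θ : Set (Fin m → ℝ)) (hΘ : IsOpen Θ)
    (ρ : EuclideanSpace ℝ (Fin d) → (Fin m → ℝ) → ℝ)
    (hρint : ∀ θ ∈ Θ, Integrable (fun x => ρ x θ))
    (hρprob : ∀ θ ∈ Θ, (∀ x, 0 ≤ ρ x θ) ∧ (∫ x, ρ x θ) = 1 ∧ ∀ x ∉ Ω, ρ x θ = 0)
    (η : EuclideanSpace ℝ (Fin d) → ℝ) (hη : Integrable η)
    (hρdiff : ∀ x, ∀ θ ∈ Θ, DifferentiableAt ℝ (ρ x) θ ∧ ‖fderiv ℝ (ρ x) θ‖ ≤ η x)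
    (c : EuclideanSpace ℝ (Fin d) × EuclideanSpace ℝ (Fin d) → ℝ)
    (hc : Continuous c) (hcnonneg : ∀ z, 0 ≤ c z)
    (ρstar : Measure (EuclideanSpace ℝ (Fin d)))
    (hρstar : IsProbabilityMeasure ρstar) (hρstarsupp : ρstar Ωᶜ = 0)
    (f : (Fin m → ℝ) → ℝ)
    (hf : ∀ θ, f θ = Tc c (volume.withDensity fun x => ENNReal.ofReal (ρ x θ)) ρstar)
    (θ₀ : Fin m → ℝ) (hθ₀ : θ₀ ∈ Θ)
    -- Gâteaux differentiability of `f` at `θ₀` with derivative `g`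
    (g : (Fin m → ℝ) →ₗ[ℝ] ℝ)
    (hg : ∀ v : Fin m → ℝ,
      Tendsto (fun t : ℝ => (f (θ₀ + t • v) - f θ₀) / t) (nhdsWithin 0 (Ioi 0))
        (nhds (g v))) :
    ∀ ε > (0 : ℝ), ∃ δ > (0 : ℝ), ∀ p ∈ dualPairs Ω c,
      ((∫ x, p.1 x * ρ x θ₀) + ∫ y, p.2 y ∂ρstar) > f θ₀ - δ →
      ∀ v : Fin m → ℝ, ‖v‖ ≤ 1 →
        |g v - ∫ x, cT2 Ω c (cT1 Ω c p.1) x * (fderiv ℝ (ρ x) θ₀) v| < ε := by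
  have := hρstar
  intro ε hε
  -- nonemptiness of Ω
  have hne : Ω.Nonempty := by
    by_contra h
    rw [Set.not_nonempty_iff_eq_empty] at h
    have h1 := (hρprob θ₀ hθ₀).2
    have : ∀ x, ρ x θ₀ = 0 := fun x => h1.2 x (by simp [h])
    simp [this] at h1
  obtain ⟨x₀, hx₀⟩ := hne
  obtain ⟨C, hC⟩ := (hΩ.prod hΩ).exists_bound_of_continuousOn hc.continuousOn
  have hzero : ∀ v : Fin m → ℝ, ∀ x ∉ Ω, (fderiv ℝ (ρ x) θ₀) v = 0 := by
    intro v x hx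
    have : ρ x =ᶠ[nhds θ₀] fun _ => 0 := by
      filter_upwards [hΘ.mem_nhds hθ₀] with θ hθ
      exact (hρprob θ hθ).2.2 x hx
    rw [this.fderiv_eq]
    simp
  have hε' : 0 < ε / (m + 1) := by positivity
  have key := fun w : Fin m → ℝ => aux_dir volume m Ω Θ hΘ ρ hρint hρprob η hη hρdiff f θ₀ hθ₀ w
    (g w) (hg w) (hzero w) C (ε / (m + 1)) hε'
  choose δ hδpos hδ using key
  have hδ' : ∃ δ₀ > 0, ∀ i : Fin m, δ₀ ≤ δ (Pi.single i 1) ∧ δ₀ ≤ δ (-Pi.single i 1) := by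
    have : ∀ᶠ s in nhdsWithin (0:ℝ) (Ioi 0), ∀ i : Fin m,
        s ≤ δ (Pi.single i 1) ∧ s ≤ δ (-Pi.single i 1) := by
      rw [eventually_all]
      intro i
      have h1 : ∀ w, ∀ᶠ s in nhdsWithin (0:ℝ) (Ioi 0), s ≤ δ w := fun w =>
        nhdsWithin_le_nhds (Iic_mem_nhds (hδpos w))
      exact (h1 _).and (h1 _)
    obtain ⟨s, hs, hs0⟩ := (this.and self_mem_nhdsWithin).exists
    exact ⟨s, hs0, hs⟩
  obtain ⟨δ₀, hδ₀pos, hδ₀⟩ := hδ'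
  refine ⟨δ₀, hδ₀pos, ?_⟩
  rintro ⟨φ, ψ⟩ ⟨hφ, hψ, hφψ⟩ hopt v hv
  dsimp only at hφ hψ hφψ hopt ⊢
  set b : EuclideanSpace ℝ (Fin d) → ℝ := cT1 Ω c φ with hb
  set A : EuclideanSpace ℝ (Fin d) → ℝ := cT2 Ω c b with hA
  have hbc : Continuous b := aux_cT1_cont hΩ hc hφ
  have hAc : Continuous A := aux_cT2_cont hΩ hc hbc
  have hAb : ∀ x ∈ Ω, ∀ y ∈ Ω, A x + b y ≤ c (x, y) := fun x _ y hy => by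
    have := aux_cT2_le hΩ hc hbc.continuousOn (x := x) hy
    linarith
  have hφA : ∀ x ∈ Ω, φ x ≤ A x := by
    intro x hx
    refine le_csInf ⟨_, x₀, hx₀, rfl⟩ ?_
    rintro _ ⟨y, hy, rfl⟩
    have := aux_cT1_le hΩ hc hφ (y := y) hx
    simp only
    linarith
  have hψb : ∀ y ∈ Ω, ψ y ≤ b y := by
    intro y hy
    refine le_csInf ⟨_, x₀, hx₀, rfl⟩ ?_
    rintro _ ⟨x, hx, rfl⟩
    have := hφψ x hx y hy
    simp only
    linarith
  have hosc : ∀ x ∈ Ω, ∀ x' ∈ Ω, A x' - C ≤ A x := by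
    intro x hx x' hx'
    refine le_csInf ⟨_, x₀, hx₀, rfl⟩ ?_
    rintro _ ⟨y, hy, rfl⟩
    have h1 := aux_cT2_le hΩ hc hbc.continuousOn (x := x') hy
    have h2 := (le_abs_self _).trans (hC (x', y) ⟨hx', hy⟩)
    have h3 := hcnonneg (x, y)
    simp only
    linarith
  obtain ⟨a, hac, ⟨B, hB⟩, haA⟩ := aux_ext hΩ hAc.continuousOn
  obtain ⟨φ', hφc, ⟨B1, hB1⟩, hφ'⟩ := aux_ext hΩ hφ
  obtain ⟨ψ', hψc, ⟨B2, hB2⟩, hψ'⟩ := aux_ext hΩ hψ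
  obtain ⟨b', hbc', ⟨B3, hB3⟩, hb'⟩ := aux_ext hΩ hbc.continuousOn
  have hae : ∀ᵐ y ∂ρstar, y ∈ Ω := hρstarsupp
  -- weak duality
  have hweak : ∀ θ ∈ Θ, (∫ x, a x * ρ x θ) + ∫ y, b y ∂ρstar ≤ f θ := by
    intro θ hθ
    obtain ⟨hpos, hone, hout⟩ := hρprob θ hθ
    have hprob : IsProbabilityMeasure
        ((volume : Measure (EuclideanSpace ℝ (Fin d))).withDensity
          fun x => ENNReal.ofReal (ρ x θ)) := by
      constructor
      rw [withDensity_apply _ MeasurableSet.univ, Measure.restrict_univ,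
        ← ofReal_integral_eq_lintegral_ofReal (hρint θ hθ) (Eventually.of_forall hpos), hone]
      simp
    have hsupp : ((volume : Measure (EuclideanSpace ℝ (Fin d))).withDensity
          fun x => ENNReal.ofReal (ρ x θ)) Ωᶜ = 0 := by
      rw [withDensity_apply _ hΩ.isClosed.measurableSet.compl]
      rw [setLIntegral_congr_fun (g := fun _ => 0) hΩ.isClosed.measurableSet.compl]
      · simp
      · intro x hx
        simp [hout x hx]
    rw [hf θ]
    have h := aux_weak hΩ hc _ ρstar hsupp hρstarsupp hac hbc
      (fun x hx y hy => by rw [haA x hx]; exact hAb x hx y hy)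
    rw [integral_withDensity_eq_integral_toReal_smul₀
      (hρint θ hθ).aestronglyMeasurable.aemeasurable.ennreal_ofReal
      (Eventually.of_forall fun x => ENNReal.ofReal_lt_top)] at h
    refine le_trans (le_of_eq ?_) h
    congr 2
    funext x
    rw [ENNReal.toReal_ofReal (hpos x), smul_eq_mul, mul_comm]
  -- improvement
  have himp : (∫ x, φ x * ρ x θ₀) + ∫ y, ψ y ∂ρstar ≤
      (∫ x, a x * ρ x θ₀) + ∫ y, b y ∂ρstar := by
    obtain ⟨hpos, hone, hout⟩ := hρprob θ₀ hθ₀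
    have e1 : (fun x => φ x * ρ x θ₀) = fun x => φ' x * ρ x θ₀ := by
      funext x
      by_cases hx : x ∈ Ω
      · rw [hφ' x hx]
      · rw [hout x hx]; simp
    rw [e1]
    refine add_le_add ?_ ?_
    · refine integral_mono
        ((hρint _ hθ₀).bdd_mul hφc.aestronglyMeasurable (Eventually.of_forall hB1))
        ((hρint _ hθ₀).bdd_mul hac.aestronglyMeasurable (Eventually.of_forall hB)) ?_
      intro x
      by_cases hx : x ∈ Ω
      · simp only
        rw [hφ' x hx, haA x hx]
        exact mul_le_mul_of_nonneg_right (hφA x hx) (hpos x)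
      · simp [hout x hx]
    · rw [integral_congr_ae (g := ψ') (by filter_upwards [hae] with y hy using (hψ' y hy).symm),
        integral_congr_ae (f := b) (g := b')
          (by filter_upwards [hae] with y hy using (hb' y hy).symm)]
      refine integral_mono_ae
        (Integrable.of_bound hψc.aestronglyMeasurable B2 (Eventually.of_forall hB2))
        (Integrable.of_bound hbc'.aestronglyMeasurable B3 (Eventually.of_forall hB3)) ?_
      filter_upwards [hae] with y hy
      rw [hψ' y hy, hb' y hy]
      exact hψb y hy
  have hosc' : ∀ x ∈ Ω, |a x - A x₀| ≤ C := by
    intro x hx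
    rw [haA x hx, abs_le]
    constructor <;> linarith [hosc x hx x₀ hx₀, hosc x₀ hx₀ x hx]
  have hcon : ∀ w : Fin m → ℝ, δ₀ ≤ δ w →
      ∫ x, a x * (fderiv ℝ (ρ x) θ₀) w < g w + ε / (m + 1) := by
    intro w hw
    exact hδ w a (A x₀) _ hac.aestronglyMeasurable ⟨B, hB⟩ hosc' hweak (by linarith)
  have hbasis : ∀ i : Fin m,
      |g (Pi.single i 1) - ∫ x, a x * (fderiv ℝ (ρ x) θ₀) (Pi.single i 1)| ≤ ε / (m + 1) := by
    intro i
    have h1 := hcon _ (hδ₀ i).1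
    have h2 := hcon _ (hδ₀ i).2
    simp only [map_neg, mul_neg, integral_neg] at h2
    rw [abs_le]
    constructor <;> linarith
  have hAa : (fun x => A x * (fderiv ℝ (ρ x) θ₀) v) = fun x => a x * (fderiv ℝ (ρ x) θ₀) v := by
    funext x
    by_cases hx : x ∈ Ω
    · rw [haA x hx]
    · rw [hzero v x hx]; simp
  rw [hAa]
  have hv' : v = ∑ i, v i • (Pi.single i (1:ℝ) : Fin m → ℝ) := pi_eq_sum_univ' v
  have hgv : g v = ∑ i, v i * g (Pi.single i 1) := by
    conv_lhs => rw [hv']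
    simp
  have hiv : ∫ x, a x * (fderiv ℝ (ρ x) θ₀) v
      = ∑ i, v i * ∫ x, a x * (fderiv ℝ (ρ x) θ₀) (Pi.single i 1) := by
    have : ∀ x, a x * (fderiv ℝ (ρ x) θ₀) v
        = ∑ i, v i * (a x * (fderiv ℝ (ρ x) θ₀) (Pi.single i 1)) := by
      intro x
      conv_lhs => rw [hv']
      rw [map_sum, Finset.mul_sum]
      refine Finset.sum_congr rfl fun i _ => ?_
      rw [map_smul, smul_eq_mul]
      ring
    simp_rw [this]
    rw [integral_finsetSum]
    · simp_rw [integral_const_mul]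
    · intro i _
      refine Integrable.const_mul ?_ _
      exact (aux_L1 volume m Θ hΘ ρ hρint η hη hρdiff θ₀ hθ₀ _).1.bdd_mul
        hac.aestronglyMeasurable (Eventually.of_forall hB)
  rw [hgv, hiv, ← Finset.sum_sub_distrib]
  calc _ ≤ ∑ i : Fin m, |v i * g (Pi.single i 1)
          - v i * ∫ x, a x * (fderiv ℝ (ρ x) θ₀) (Pi.single i 1)| :=
        Finset.abs_sum_le_sum_abs _ _
    _ ≤ ∑ i : Fin m, ε / (m + 1) := by
        refine Finset.sum_le_sum fun i _ => ?_
        rw [← mul_sub, abs_mul]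
        have h1 : |v i| ≤ 1 := (norm_le_pi_norm v i).trans hv
        calc _ ≤ 1 * (ε / (m + 1)) :=
              mul_le_mul h1 (hbasis i) (abs_nonneg _) zero_le_one
          _ = _ := one_mul _
    _ = m * (ε / (m + 1)) := by simp
    _ < ε := by
        rw [mul_div_assoc', div_lt_iff₀ (by positivity)]
        nlinarith
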